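/- arXiv:0809.4169 — 2 statements merged into one kernel-verified Lean document; each statement's English description precedes it below -/
import Mathlib

section
/- Let A ↪ B be an injective flat ring homomorphism of commutative rings and Q a pure ideal of A with QB = Q. For any A-module E, pd_A(E) ≤ d if and only if pd_B(E ⊗_A B) ≤ d and pd_{A/Q}(E ⊗_A (A/Q)) ≤ d. -/
open CategoryTheory CategoryTheory.Limits

noncomputable section

universe u

/-- `pdLE R M n` : the projective dimension of the `R`-module `M` is at most `n`,
expressed by the vanishing of `Ext^{n+1}(M, N)` for all `N`. -/
def pdLE (R : Type u) [CommRing R] (M : Type u) [AddCommGroup M] [Module R M] (n : ℕ) : Prop :=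
  ∀ N : ModuleCat.{u} R,
    IsZero (((Ext R (ModuleCat.{u} R) (n + 1)).obj (Opposite.op (ModuleCat.of R M))).obj N)

/-- `fdLE R M n` : the flat dimension of the `R`-module `M` is at most `n`,
expressed by the vanishing of `Tor_{n+1}(M, N)` for all `N`. -/
def fdLE (R : Type u) [CommRing R] (M : Type u) [AddCommGroup M] [Module R M] (n : ℕ) : Prop :=
  ∀ N : ModuleCat.{u} R,
    IsZero (((Tor' (ModuleCat.{u} R) (n + 1)).obj (ModuleCat.of R M)).obj N)

/-- A commutative ring `R` is strong `n`-perfect if every `R`-module of flat dimension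
at most `n` has projective dimension at most `n`. -/
def IsStrongNPerfect (R : Type u) [CommRing R] (n : ℕ) : Prop :=
  ∀ (M : Type u) [AddCommGroup M] [Module R M], fdLE R M n → pdLE R M n


section
open TensorProduct

/-- Vanishing of the old `Ext` is the same as vanishing of `Abelian.Ext`. -/
lemma isZero_Ext_iff_subsingleton (R : Type u) [CommRing R] (M N : ModuleCat.{u} R) (n : ℕ) :
    IsZero (((Ext R (ModuleCat.{u} R) (n + 1)).obj (Opposite.op M)).obj N) ↔
      Subsingleton (Abelian.Ext.{u} M N (n + 1)) := by
  let P := projectiveResolution M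
  rw [(P.isoExt (R := R) (n + 1) N).isZero_iff,
    ← HomologicalComplex.exactAt_iff_isZero_homology,
    HomologicalComplex.exactAt_iff' _ n (n + 1) (n + 2) (by simp) (by simp),
    ShortComplex.moduleCat_exact_iff]
  constructor
  · intro h
    refine subsingleton_of_forall_eq 0 fun α => ?_
    obtain ⟨f, hf, rfl⟩ := P.extMk_surjective α (n + 2) rfl
    rw [P.extMk_eq_zero_iff f (n + 2) rfl hf n rfl]
    exact h f hf
  · intro h f hf
    exact (P.extMk_eq_zero_iff f (n + 2) rfl hf n rfl).1 (Subsingleton.elim _ _)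

lemma pdLE_iff_subsingleton (R : Type u) [CommRing R] (M : Type u) [AddCommGroup M] [Module R M]
    (n : ℕ) : pdLE R M n ↔
      ∀ N : ModuleCat.{u} R, Subsingleton (Abelian.Ext.{u} (ModuleCat.of R M) N (n + 1)) :=
  forall_congr' fun N => isZero_Ext_iff_subsingleton R _ N n

lemma pdLE_zero_iff (R : Type u) [CommRing R] (M : Type u) [AddCommGroup M] [Module R M] :
    pdLE R M 0 ↔ Module.Projective R M := by
  rw [pdLE_iff_subsingleton, IsProjective.iff_projective,
    projective_iff_subsingleton_ext_one.{u}]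

lemma pdLE_succ_iff (R : Type u) [CommRing R] {K F M : Type u} [AddCommGroup K] [Module R K]
    [AddCommGroup F] [Module R F] [AddCommGroup M] [Module R M] [Module.Projective R F]
    (f : K →ₗ[R] F) (g : F →ₗ[R] M) (hf : Function.Injective f) (hg : Function.Surjective g)
    (hfg : Function.Exact f g) (n : ℕ) : pdLE R M (n + 1) ↔ pdLE R K n := by
  rw [pdLE_iff_subsingleton, pdLE_iff_subsingleton]
  let S : ShortComplex (ModuleCat.{u} R) :=
    ShortComplex.mk (ModuleCat.ofHom f) (ModuleCat.ofHom g) (by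
      ext x; exact hfg.apply_apply_eq_zero x)
  have hS : S.ShortExact :=
    { exact := (ShortComplex.ShortExact.moduleCat_exact_iff_function_exact S).2 hfg
      mono_f := (ModuleCat.mono_iff_injective _).2 hf
      epi_g := (ModuleCat.epi_iff_surjective _).2 hg }
  have : Projective S.X₂ := (IsProjective.iff_projective (R := R) F).1 inferInstance
  refine forall_congr' fun N => ⟨fun h => ?_, fun h => ?_⟩
  · refine subsingleton_of_forall_eq 0 fun (x : Abelian.Ext S.X₁ N (n + 1)) => ?_
    obtain ⟨y, rfl⟩ := Abelian.Ext.contravariant_sequence_exact₁ hS N x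
      (n₁ := n + 1 + 1) (by omega) (h.elim _ _)
    rw [y.eq_zero_of_projective, Abelian.Ext.comp_zero]
  · refine subsingleton_of_forall_eq 0 fun (x : Abelian.Ext S.X₃ N (n + 1 + 1)) => ?_
    obtain ⟨y, rfl⟩ := Abelian.Ext.contravariant_sequence_exact₃ hS N x
      (Abelian.Ext.eq_zero_of_projective _) (n₀ := n + 1) (by omega)
    rw [show y = 0 from h.elim _ _, Abelian.Ext.comp_zero]

lemma exists_extend {A C : Type u} [CommRing A] [CommRing C] [Algebra A C] [Module.Flat A C]
    {N X E M : Type u} [AddCommGroup N] [Module A N] [AddCommGroup X] [Module A X]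
    [AddCommGroup E] [Module A E] [Module.Projective C (C ⊗[A] E)]
    [AddCommGroup M] [Module A M] [Module C M] [IsScalarTower A C M]
    (f : N →ₗ[A] X) (g : X →ₗ[A] E) (hf : Function.Injective f) (hg : Function.Surjective g)
    (hfg : Function.Exact f g) (h : N →ₗ[A] M) : ∃ k : X →ₗ[A] M, k ∘ₗ f = h := by
  have hf' : Function.Injective (f.baseChange C) :=
    Module.Flat.lTensor_preserves_injective_linearMap f hf
  have hg' : Function.Surjective (g.baseChange C) := LinearMap.lTensor_surjective C hg
  have hfg' : Function.Exact (f.baseChange C) (g.baseChange C) := lTensor_exact C hfg hg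
  obtain ⟨s, hs⟩ := Module.projective_lifting_property (g.baseChange C) LinearMap.id hg'
  have h01 := hfg'.split_tfae'.out 0 1
  obtain ⟨-, r, hr⟩ := h01.1 ⟨hf', s, hs⟩
  refine ⟨((LinearMap.liftBaseChange C h ∘ₗ r).restrictScalars A) ∘ₗ
    TensorProduct.mk A C X 1, ?_⟩
  ext x
  have := LinearMap.congr_fun hr (1 ⊗ₜ x)
  simp only [LinearMap.comp_apply, LinearMap.baseChange_tmul, LinearMap.id_apply] at this
  simp [this]

lemma local_unit_add {A Z : Type u} [CommRing A] [AddCommGroup Z] [Module A Z]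
    (e e' : A) (x y : Z) (hx : e • x = x) (hy : e' • y = y) :
    (e + e' - e * e') • (x + y) = x + y := by
  have h1 : (e * e') • x = e' • x := by rw [mul_comm, mul_smul, hx]
  have h2 : (e * e') • y = e • y := by rw [mul_smul, hy]
  rw [sub_smul, add_smul, smul_add, smul_add, smul_add, h1, h2, hx, hy]
  abel

lemma exists_local_unit {A : Type u} [CommRing A] (Q : Ideal A) (hpure : Q.Pure)
    {N : Type u} [AddCommGroup N] [Module A N] (z : Q ⊗[A] N) : ∃ e ∈ Q, e • z = z := by
  induction z with
  | zero => exact ⟨0, Q.zero_mem, by simp⟩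
  | tmul q n =>
    obtain ⟨e, he, h⟩ := Ideal.exists_eq_mul_of_pure q.2
    refine ⟨e, he, ?_⟩
    rw [TensorProduct.smul_tmul']
    congr 1
    ext
    simp only [SetLike.val_smul, smul_eq_mul]
    rw [mul_comm]; exact h.symm
  | add x y hx hy =>
    obtain ⟨e, he, hx⟩ := hx
    obtain ⟨e', he', hy⟩ := hy
    refine ⟨e + e' - e * e', Q.sub_mem (Q.add_mem he he') (Q.mul_mem_right _ he), ?_⟩
    exact local_unit_add e e' x y hx hy

lemma smul_eq_tmul {A : Type u} [CommRing A] (Q : Ideal A)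
    {N : Type u} [AddCommGroup N] [Module A N] (z : Q ⊗[A] N) (e : Q) :
    (e : A) • z = e ⊗ₜ TensorProduct.lift ((LinearMap.lsmul A N).comp Q.subtype) z := by
  induction z with
  | zero => simp
  | tmul q n =>
    simp only [lift.tmul, LinearMap.comp_apply, LinearMap.lsmul_apply, Submodule.subtype_apply]
    rw [← TensorProduct.smul_tmul, TensorProduct.smul_tmul']
    congr 1
    ext
    simp [mul_comm]
  | add x y hx hy => rw [smul_add, hx, hy, map_add, tmul_add]

lemma smulMap_injective {A : Type u} [CommRing A] (Q : Ideal A) (hpure : Q.Pure)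
    {N : Type u} [AddCommGroup N] [Module A N] :
    Function.Injective (TensorProduct.lift ((LinearMap.lsmul A N).comp Q.subtype) :
      Q ⊗[A] N →ₗ[A] N) := by
  rw [injective_iff_map_eq_zero]
  intro z hz
  obtain ⟨e, he, h⟩ := exists_local_unit Q hpure z
  rw [← h, smul_eq_tmul Q z ⟨e, he⟩, hz, tmul_zero]

lemma range_smulMap {A : Type u} [CommRing A] (Q : Ideal A)
    {N : Type u} [AddCommGroup N] [Module A N] :
    LinearMap.range (TensorProduct.lift ((LinearMap.lsmul A N).comp Q.subtype) :
      Q ⊗[A] N →ₗ[A] N) = Q • ⊤ := by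
  apply le_antisymm
  · rintro _ ⟨z, rfl⟩
    induction z with
    | zero => simp
    | tmul q n => exact Submodule.smul_mem_smul q.2 trivial
    | add x y hx hy => rw [map_add]; exact add_mem hx hy
  · rw [Submodule.smul_le]
    intro q hq n _
    exact ⟨⟨q, hq⟩ ⊗ₜ n, by simp⟩

lemma exists_projective_cover (A : Type u) [CommRing A] (E : Type u) [AddCommGroup E]
    [Module A E] : ∃ (F : Type u) (_ : AddCommGroup F) (_ : Module A F)
      (_ : Module.Projective A F) (π : F →ₗ[A] E), Function.Surjective π :=
  ⟨E →₀ A, inferInstance, inferInstance, inferInstance, Finsupp.linearCombination A id,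
    Finsupp.linearCombination_id_surjective A E⟩

lemma projective_of_pure {A B : Type u} [CommRing A] [CommRing B] [Algebra A B]
    (hinj : Function.Injective (algebraMap A B)) [Module.Flat A B]
    (Q : Ideal A) (hpure : Module.Flat A (A ⧸ Q))
    (hQB : (Q.map (algebraMap A B) : Set B) = algebraMap A B '' Q)
    (E : Type u) [AddCommGroup E] [Module A E] [Module.Projective B (B ⊗[A] E)]
    [Module.Projective (A ⧸ Q) ((A ⧸ Q) ⊗[A] E)] : Module.Projective A E := by
  obtain ⟨F, _, _, _, π, hπ⟩ := exists_projective_cover A E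
  let N := LinearMap.ker π
  let q : N →ₗ[A] N ⧸ (Q • ⊤ : Submodule A N) := Submodule.mkQ _
  obtain ⟨ρ, hρ⟩ := exists_extend (C := A ⧸ Q) N.subtype π N.injective_subtype hπ
    π.exact_subtype_ker_map q
  have hρ' (n : N) : ρ n = Submodule.Quotient.mk n := LinearMap.congr_fun hρ n
  let G := LinearMap.ker ρ
  let μ : Q ⊗[A] N →ₗ[A] N := TensorProduct.lift ((LinearMap.lsmul A N).comp Q.subtype)
  have hμr : LinearMap.range μ = Q • ⊤ := range_smulMap Q
  let f : Q ⊗[A] N →ₗ[A] G := (N.subtype ∘ₗ μ).codRestrict G (fun z => by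
    rw [LinearMap.mem_ker, LinearMap.comp_apply, Submodule.subtype_apply, hρ', Submodule.Quotient.mk_eq_zero, ← hμr]
    exact ⟨z, rfl⟩)
  have hfv (z) : (f z : F) = μ z := rfl
  let g : G →ₗ[A] E := π ∘ₗ G.subtype
  have hf : Function.Injective f := fun x y hxy => by
    apply smulMap_injective Q hpure
    have h : ((μ x : N) : F) = (μ y : N) := by rw [← hfv, ← hfv, hxy]
    exact Subtype.ext h
  have hg : Function.Surjective g := fun x => by
    obtain ⟨y, rfl⟩ := hπ x
    obtain ⟨n, hn⟩ := Submodule.Quotient.mk_surjective _ (ρ y)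
    refine ⟨⟨y - n, ?_⟩, ?_⟩
    · rw [LinearMap.mem_ker, map_sub, hρ', hn, sub_self]
    · have : π n = 0 := n.2
      simp [g, this]
  have hfg : Function.Exact f g := by
    intro x
    constructor
    · intro hx
      have h1 : (x : F) ∈ N := hx
      have h2 : ρ ((⟨x, h1⟩ : N) : F) = 0 := x.2
      rw [hρ', Submodule.Quotient.mk_eq_zero, ← hμr] at h2
      obtain ⟨z, hz⟩ := h2
      refine ⟨z, Subtype.ext ?_⟩
      rw [hfv, hz]
    · rintro ⟨z, rfl⟩
      exact (μ z).2
  let I := Q.map (algebraMap A B)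
  let φ₀ : Q →ₗ[A] I :=
    { toFun := fun q => ⟨algebraMap A B q, Ideal.mem_map_of_mem _ q.2⟩
      map_add' := fun x y => by ext; simp
      map_smul' := fun a x => by ext; simp [Algebra.smul_def] }
  have hφ₀ : Function.Bijective φ₀ := by
    constructor
    · intro x y hxy
      exact Subtype.ext (hinj (congrArg Subtype.val hxy))
    · rintro ⟨y, hy⟩
      have : y ∈ algebraMap A B '' Q := hQB ▸ hy
      obtain ⟨q, hq, rfl⟩ := this
      exact ⟨⟨q, hq⟩, rfl⟩
  let φ := LinearEquiv.ofBijective φ₀ hφ₀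
  let ψ : Q ⊗[A] N ≃ₗ[A] I ⊗[A] N := TensorProduct.congr φ (LinearEquiv.refl A N)
  obtain ⟨k, hk⟩ := exists_extend (C := B) f g hf hg hfg ψ.toLinearMap
  have h10 := hfg.split_tfae'.out 1 0
  obtain ⟨-, s, hs⟩ := h10.1 ⟨hg, ψ.symm.toLinearMap ∘ₗ k, by
    rw [LinearMap.comp_assoc, hk]; ext; simp⟩
  exact Module.Projective.of_split (G.subtype ∘ₗ s) π hs

end

open TensorProduct in
theorem pdLE_iff_of_pure_ideal
    (A B : Type u) [CommRing A] [CommRing B] [Algebra A B]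
    (hinj : Function.Injective (algebraMap A B)) [Module.Flat A B]
    (Q : Ideal A) (hpure : Module.Flat A (A ⧸ Q))
    (hQB : (Q.map (algebraMap A B) : Set B) = algebraMap A B '' Q)
    (E : Type u) [AddCommGroup E] [Module A E] (d : ℕ) :
    pdLE A E d ↔ pdLE B (B ⊗[A] E) d ∧ pdLE (A ⧸ Q) ((A ⧸ Q) ⊗[A] E) d := by
  induction d generalizing E with
  | zero =>
    simp only [pdLE_zero_iff]
    constructor
    · intro h
      exact ⟨inferInstance, inferInstance⟩
    · rintro ⟨h1, h2⟩
      exact projective_of_pure hinj Q hpure hQB E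
  | succ d ih =>
    obtain ⟨F, _, _, _, π, hπ⟩ := exists_projective_cover A E
    let N := LinearMap.ker π
    have key (C : Type u) [CommRing C] [Algebra A C] [Module.Flat A C] :
        pdLE C (C ⊗[A] E) (d + 1) ↔ pdLE C (C ⊗[A] N) d :=
      pdLE_succ_iff C (N.subtype.baseChange C) (π.baseChange C)
        (Module.Flat.lTensor_preserves_injective_linearMap _ N.injective_subtype)
        (LinearMap.lTensor_surjective C hπ)
        (lTensor_exact C π.exact_subtype_ker_map hπ) d
    rw [key B, key (A ⧸ Q), ← ih N,
      pdLE_succ_iff A N.subtype π N.injective_subtype hπ π.exact_subtype_ker_map d]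
end
end

section
/- Let A ↪ B be an injective flat ring homomorphism of commutative rings and Q a pure ideal of A with QB = Q. If both B and A/Q are strong n-perfect rings, then A is a strong n-perfect ring. -/
open CategoryTheory CategoryTheory.Limits

noncomputable section

universe u

lemma tor_iff (R : Type u) [CommRing R] (M : ModuleCat.{u} R) (P : ProjectiveResolution M)
    (n : ℕ) (N : ModuleCat.{u} R) :
    IsZero (((Tor' (ModuleCat.{u} R) (n + 1)).obj M).obj N) ↔
    Function.Exact (LinearMap.rTensor N (P.complex.d (n+2) (n+1)).hom)
      (LinearMap.rTensor N (P.complex.d (n+1) n).hom) := by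
  rw [Tor'_obj_obj]
  rw [(P.isoLeftDerivedObj ((MonoidalCategory.tensoringRight _).obj N) (n+1)).isZero_iff]
  erw [← HomologicalComplex.exactAt_iff_isZero_homology]
  rw [HomologicalComplex.exactAt_iff' _ (n+2) (n+1) n (by simp) (by simp)]
  rw [ShortComplex.ShortExact.moduleCat_exact_iff_function_exact]
  rfl

lemma ext_iff (R : Type u) [CommRing R] (M : ModuleCat.{u} R) (P : ProjectiveResolution M)
    (n : ℕ) (N : ModuleCat.{u} R) :
    IsZero (((Ext R (ModuleCat.{u} R) (n + 1)).obj (Opposite.op M)).obj N) ↔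
    ∀ g : P.complex.X (n+1) ⟶ N, P.complex.d (n+2) (n+1) ≫ g = 0 →
      ∃ h : P.complex.X n ⟶ N, P.complex.d (n+1) n ≫ h = g := by
  rw [(P.isoExt (R := R) (n+1) N).isZero_iff]
  rw [← HomologicalComplex.exactAt_iff_isZero_homology]
  rw [HomologicalComplex.exactAt_iff' _ n (n+1) (n+2) (by simp) (by simp)]
  rw [ShortComplex.moduleCat_exact_iff]
  rfl

instance (R S : Type u) [CommRing R] [CommRing S] (f : R →+* S) :
   (ModuleCat.extendScalars.{u,u,u} f).Additive := by
  exact (ModuleCat.extendRestrictScalarsAdj.{u,u,u} f).left_adjoint_additive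

lemma ext_base (R S : Type u) [CommRing R] [CommRing S] (f : R →+* S) (M : ModuleCat.{u} R) (P : ProjectiveResolution M) (P' : ProjectiveResolution ((ModuleCat.extendScalars f).obj M))
   (hP : P'.complex = ((ModuleCat.extendScalars f).mapHomologicalComplex _).obj P.complex)
    (n : ℕ) (N : ModuleCat.{u} S)
    (H : IsZero (((Ext S (ModuleCat.{u} S) (n + 1)).obj (Opposite.op ((ModuleCat.extendScalars f).obj M))).obj N)) :
   IsZero (((Ext R (ModuleCat.{u} R) (n + 1)).obj (Opposite.op M)).obj ((ModuleCat.restrictScalars f).obj N)) := by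
  rw [ext_iff _ _ P'] at H
  rw [hP] at H
  rw [ext_iff _ _ P]
  intro g hg
  let adj := ModuleCat.extendRestrictScalarsAdj.{u,u,u} f
  obtain ⟨h, hh⟩ := H ((adj.homEquiv _ _).symm g) (by
    have := (adj.homEquiv_naturality_left_symm (P.complex.d (n+2) (n+1)) g).symm
    refine this.trans ?_
    rw [hg]
    exact ((adj.homAddEquiv _ _).symm).map_zero)
  refine ⟨adj.homEquiv _ _ h, ?_⟩
  have h2 := adj.homEquiv_naturality_left (P.complex.d (n+1) n) h
  refine h2.symm.trans ?_
  rw [← Equiv.eq_symm_apply]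
  exact hh

lemma tor_base (R S : Type u) [CommRing R] [CommRing S] (f : R →+* S) (M : ModuleCat.{u} R) (P : ProjectiveResolution M) (P' : ProjectiveResolution ((ModuleCat.extendScalars f).obj M))
   (hP : P'.complex = ((ModuleCat.extendScalars f).mapHomologicalComplex _).obj P.complex)
    (n : ℕ) (N : ModuleCat.{u} S)
    (H : IsZero (((Tor' (ModuleCat.{u} R) (n + 1)).obj M).obj ((ModuleCat.restrictScalars f).obj N))) :
   IsZero (((Tor' (ModuleCat.{u} S) (n + 1)).obj ((ModuleCat.extendScalars f).obj M)).obj N) := by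
  rw [tor_iff _ _ P] at H
  rw [tor_iff _ _ P', hP]
  let _ := f.toAlgebra
  let _ : Module R N := Module.compHom N f
  have : IsScalarTower R S N := IsScalarTower.of_algebraMap_smul (fun r x => rfl)
  let e (X : ModuleCat.{u} R) : TensorProduct S (TensorProduct R S X) N ≃ₗ[S] TensorProduct R N X :=
    (TensorProduct.comm _ _ _).trans (TensorProduct.AlgebraTensorModule.cancelBaseChange R S S N X)
  let e' (X : ModuleCat.{u} R) : TensorProduct S (TensorProduct R S X) N ≃+ TensorProduct R X N :=
    (e X).toAddEquiv.trans (TensorProduct.comm R N X).toAddEquiv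
  have he (X : ModuleCat.{u} R) (s : S) (x : X) (y : N) :
    e' X (TensorProduct.tmul S (TensorProduct.tmul R s x) y) = TensorProduct.tmul R x (s • y) := by
    simp [e', e]
  have key (X Y : ModuleCat.{u} R) (g : X ⟶ Y) (t : TensorProduct S (TensorProduct R S X) N) :
     e' Y (LinearMap.rTensor N (g.hom.baseChange S) t) = LinearMap.rTensor N g.hom (e' X t) := by
    induction t with
    | zero => simp
    | add a b ha hb => simp only [map_add, ha, hb]
    | tmul a y => 
      induction a with
      | zero => simp
      | add a b ha hb => simp only [TensorProduct.add_tmul, map_add, ha, hb]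
      | tmul s x => simp [he]
  let d2 := P.complex.d (n+2) (n+1)
  let d1 := P.complex.d (n+1) n
  have H' : Function.Exact (LinearMap.rTensor N d2.hom) (LinearMap.rTensor N d1.hom) := H
  have goal : Function.Exact (LinearMap.rTensor N (d2.hom.baseChange S))
      (LinearMap.rTensor N (d1.hom.baseChange S)) := by
    intro t
    constructor
    · intro ht
      obtain ⟨s, hs⟩ := (H' (e' _ t)).1 (by rw [← key, ht, map_zero])
      refine ⟨(e' _).symm s, (e' _).injective ?_⟩
      rw [key, AddEquiv.apply_symm_apply, hs]
    · rintro ⟨s, rfl⟩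
      apply (e' _).injective
      rw [key, key, map_zero]
      exact (H' _).2 ⟨_, rfl⟩
  exact goal

lemma ext_vanish (R S : Type u) [CommRing R] [CommRing S] (f : R →+* S) (hf : f.Flat)
    (n : ℕ) (hS : IsStrongNPerfect S n)
    (M : ModuleCat.{u} R) (hM : fdLE R M n) (N : ModuleCat.{u} S) :
    IsZero (((Ext R (ModuleCat.{u} R) (n + 1)).obj (Opposite.op M)).obj
      ((ModuleCat.restrictScalars f).obj N)) := by
  have := ModuleCat.preservesFiniteLimits_extendScalars_of_flat hf
  have : (ModuleCat.extendScalars.{u,u,u} f).PreservesHomology := inferInstance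
  have : (ModuleCat.extendScalars.{u,u,u} f).PreservesProjectiveObjects :=
    ⟨fun h => (ModuleCat.extendRestrictScalarsAdj.{u,u,u} f).map_projective _ h⟩
  let P := ProjectiveResolution.of M
  let P' := (ModuleCat.extendScalars.{u,u,u} f).mapProjectiveResolution P
  refine ext_base R S f M P P' rfl n N ?_
  let X : ModuleCat.{u} S := (ModuleCat.extendScalars.{u,u,u} f).obj M
  exact @hS X X.isAddCommGroup X.isModule
    (fun N' => tor_base R S f M P P' rfl n N' (hM _)) N

lemma ext_vanish' (R S : Type u) [CommRing R] [CommRing S] [Algebra R S] [Module.Flat R S]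
    (n : ℕ) (hS : IsStrongNPerfect S n)
    (M : ModuleCat.{u} R) (hM : fdLE R M n) (N : Type u) [AddCommGroup N] [Module R N]
    [Module S N] [IsScalarTower R S N] :
    IsZero (((Ext R (ModuleCat.{u} R) (n + 1)).obj (Opposite.op M)).obj (ModuleCat.of R N)) := by
  have h := ext_vanish R S (algebraMap R S) (RingHom.flat_algebraMap_iff.2 inferInstance) n hS M hM
    (ModuleCat.of S N)
  let e : (ModuleCat.restrictScalars (algebraMap R S)).obj (ModuleCat.of S N) ≃ₗ[R] N :=
    { AddEquiv.refl N with
      map_smul' := fun r x => algebraMap_smul S r (show N from x) }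
  exact h.of_iso (((Ext R (ModuleCat.{u} R) (n + 1)).obj (Opposite.op M)).mapIso
    e.toModuleIso).symm

lemma ext_middle (R : Type u) [CommRing R] (M : ModuleCat.{u} R) (n : ℕ)
    (X N Y : Type u) [AddCommGroup X] [Module R X] [AddCommGroup N] [Module R N]
    [AddCommGroup Y] [Module R Y] (φ : X →ₗ[R] N) (ψ : N →ₗ[R] Y)
    (hφ : Function.Injective φ) (hψ : Function.Surjective ψ) (hex : Function.Exact φ ψ)
    (hX : IsZero (((Ext R (ModuleCat.{u} R) (n + 1)).obj (Opposite.op M)).obj (ModuleCat.of R X)))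
    (hY : IsZero (((Ext R (ModuleCat.{u} R) (n + 1)).obj (Opposite.op M)).obj
      (ModuleCat.of R Y))) :
    IsZero (((Ext R (ModuleCat.{u} R) (n + 1)).obj (Opposite.op M)).obj (ModuleCat.of R N)) := by
  let P := ProjectiveResolution.of M
  rw [ext_iff _ _ P] at hX hY ⊢
  intro g hg
  have : Mono (ModuleCat.ofHom φ) := (ModuleCat.mono_iff_injective _).2 hφ
  have : Epi (ModuleCat.ofHom ψ) := (ModuleCat.epi_iff_surjective _).2 hψ
  let S : ShortComplex (ModuleCat.{u} R) := ShortComplex.mk (ModuleCat.ofHom φ) (ModuleCat.ofHom ψ)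
    (by ext x; exact (hex _).2 ⟨x, rfl⟩)
  have hS : S.Exact := (ShortComplex.ShortExact.moduleCat_exact_iff_function_exact S).2 hex
  have : Mono S.f := ‹_›
  obtain ⟨h, hh⟩ := hY (g ≫ ModuleCat.ofHom ψ) (by rw [← Category.assoc, hg, zero_comp])
  have hp := P.projective n
  let h' := Projective.factorThru h (ModuleCat.ofHom ψ)
  have hcomp : h' ≫ ModuleCat.ofHom ψ = h := Projective.factorThru_comp _ _
  let k := hS.lift (g - P.complex.d (n+1) n ≫ h') (by
    change (g - P.complex.d (n+1) n ≫ h') ≫ ModuleCat.ofHom ψ = 0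
    rw [Preadditive.sub_comp, Category.assoc, hcomp, hh, sub_self])
  have hk : k ≫ ModuleCat.ofHom φ = g - P.complex.d (n+1) n ≫ h' := hS.lift_f _ _
  obtain ⟨l, hl⟩ := hX k (by
    rw [← cancel_mono (ModuleCat.ofHom φ), Category.assoc, hk, Preadditive.comp_sub, hg]
    simp)
  refine ⟨l ≫ ModuleCat.ofHom φ + h', ?_⟩
  rw [Preadditive.comp_add, ← Category.assoc, hl, hk, sub_add_cancel]

theorem strongNPerfect_of_pullback
    (A B : Type u) [CommRing A] [CommRing B] [Algebra A B]
    (hinj : Function.Injective (algebraMap A B)) [Module.Flat A B]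
    (Q : Ideal A) (hpure : Module.Flat A (A ⧸ Q))
    (hQB : (Q.map (algebraMap A B) : Set B) = algebraMap A B '' Q)
    (n : ℕ) (hB : IsStrongNPerfect B n) (hAQ : IsStrongNPerfect (A ⧸ Q) n) :
    IsStrongNPerfect A n := by
  intro M _ _ hM N
  let Q' : Ideal B := Q.map (algebraMap A B)
  have hmem : ∀ b : B, b ∈ Q' ↔ ∃ a ∈ Q, algebraMap A B a = b := fun b => by
    rw [← SetLike.mem_coe, hQB]; rfl
  let i : Q →ₗ[A] Q' :=
    { toFun := fun a => ⟨algebraMap A B a, (hmem _).2 ⟨a, a.2, rfl⟩⟩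
      map_add' := fun a b => Subtype.ext (by simp)
      map_smul' := fun a b => Subtype.ext (by simp [Algebra.smul_def]) }
  let e : Q ≃ₗ[A] Q' := LinearEquiv.ofBijective i
    ⟨fun a b hab => Subtype.ext (hinj (congrArg Subtype.val hab)),
     fun ⟨b, hb⟩ => by
      obtain ⟨a, ha, rfl⟩ := (hmem b).1 hb
      exact ⟨⟨a, ha⟩, rfl⟩⟩
  let j : Q' →ₗ[A] A := Q.subtype ∘ₗ e.symm.toLinearMap
  have hj : Function.Injective j := Subtype.val_injective.comp e.symm.injective
  have hjex : Function.Exact j (Submodule.mkQ Q) := by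
    rw [LinearMap.exact_iff]
    simp [j, LinearMap.range_comp]
  have hinjT := LinearMap.lTensor_injective_of_exact_of_flat (Submodule.mkQ Q)
    (Submodule.mkQ_surjective Q) j hj hjex N
  have hexT := lTensor_exact N hjex (Submodule.mkQ_surjective Q)
  have hsurjT := LinearMap.lTensor_surjective N (Submodule.mkQ_surjective Q)
  let r := TensorProduct.rid A N
  let φ : TensorProduct A Q' N →ₗ[A] N :=
    r.toLinearMap ∘ₗ LinearMap.lTensor N j ∘ₗ (TensorProduct.comm A Q' N).toLinearMap
  let ψ : N →ₗ[A] TensorProduct A (A ⧸ Q) N :=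
    (TensorProduct.comm A N (A ⧸ Q)).toLinearMap ∘ₗ LinearMap.lTensor N (Submodule.mkQ Q) ∘ₗ
      r.symm.toLinearMap
  refine ext_middle A (ModuleCat.of A M) n (TensorProduct A Q' N) N (TensorProduct A (A ⧸ Q) N)
    φ ψ ?_ ?_ ?_ ?_ ?_
  · exact r.injective.comp (hinjT.comp (TensorProduct.comm A Q' N).injective)
  · exact (TensorProduct.comm A N (A ⧸ Q)).surjective.comp (hsurjT.comp r.symm.surjective)
  · intro x
    constructor
    · intro hx
      have h1 : LinearMap.lTensor N (Submodule.mkQ Q) (r.symm x) = 0 :=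
        (TensorProduct.comm A N (A ⧸ Q)).injective (hx.trans (map_zero _).symm)
      obtain ⟨y, hy⟩ := (hexT _).1 h1
      refine ⟨(TensorProduct.comm A Q' N).symm y, ?_⟩
      change r (LinearMap.lTensor N j ((TensorProduct.comm A Q' N)
        ((TensorProduct.comm A Q' N).symm y))) = x
      rw [LinearEquiv.apply_symm_apply, hy, LinearEquiv.apply_symm_apply]
    · rintro ⟨y, rfl⟩
      change (TensorProduct.comm A N (A ⧸ Q)) (LinearMap.lTensor N (Submodule.mkQ Q)
        (r.symm (r (LinearMap.lTensor N j ((TensorProduct.comm A Q' N) y))))) = 0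
      rw [LinearEquiv.symm_apply_apply, (hexT _).2 ⟨_, rfl⟩, map_zero]
  · exact ext_vanish' A B n hB (ModuleCat.of A M) hM (TensorProduct A Q' N)
  · exact ext_vanish' A (A ⧸ Q) n hAQ (ModuleCat.of A M) hM (TensorProduct A (A ⧸ Q) N)
end
end
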